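/- arXiv:2405.13772 — 4 statements merged into one kernel-verified Lean document; each statement's English description precedes it below -/
import Mathlib

section
/- Let t^α = t^{2μ} t_J and t^β = t^{2ν} t_K be monomials of K[E_G], where μ, ν ∈ ℕ^{E_G} and J, K ⊆ E_G, and let (T₁, p₁) and (T₂, p₂) be the unique pairs such that J is a (T₁, p₁)-join and K is a (T₂, p₂)-join. Then t^α − t^β ∈ I(G) if and only if (T₁, p₁) = (T₂, p₂) and t^α − t^β is homogeneous (i.e. deg t^α = deg t^β). -/
open MvPolynomial Finset

variable {n : ℕ}

/-- The monomial `x_i * x_j` attached to an edge `{i,j}`. -/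
noncomputable def edgeMono (K : Type*) [Field K] (e : Sym2 (Fin n)) :
    MvPolynomial (Fin n) K :=
  Sym2.lift ⟨fun i j => X i * X j, fun _ _ => mul_comm _ _⟩ e

/-- The map `φ : K[E_G] → K[x_1,…,x_n]`, `t_e ↦ x_i x_j` for `e = {i,j}`. -/
noncomputable def phiG (K : Type*) [Field K] (G : SimpleGraph (Fin n)) :
    MvPolynomial G.edgeSet K →ₐ[K] MvPolynomial (Fin n) K :=
  aeval (fun e => edgeMono K e.1)

/-- The Eulerian ideal `I(G) = φ⁻¹(x_i² - x_j² : i, j)`. -/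
noncomputable def eulerianIdeal (K : Type*) [Field K] (G : SimpleGraph (Fin n)) :
    Ideal (MvPolynomial G.edgeSet K) :=
  Ideal.comap (phiG K G) (Ideal.span {f | ∃ i j : Fin n, f = X i ^ 2 - X j ^ 2})

/-- `deg_J(i)`: the number of edges of `J` containing the vertex `i`. -/
def degIn (G : SimpleGraph (Fin n)) (J : Finset G.edgeSet) (i : Fin n) : ℕ :=
  (J.filter fun e => i ∈ e.val).card

/-- A set of edges is Eulerian if every vertex has even degree in it. -/
def IsEulerianSet (G : SimpleGraph (Fin n)) (C : Finset G.edgeSet) : Prop :=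
  ∀ i : Fin n, Even (degIn G C i)

/-- `J` is a `T`-join. -/
def IsTJoin (G : SimpleGraph (Fin n)) (T : Finset (Fin n)) (J : Finset G.edgeSet) : Prop :=
  ∀ i : Fin n, i ∈ T ↔ Odd (degIn G J i)

/-- `J` is a `(T,p)`-join. -/
def IsTPJoin (G : SimpleGraph (Fin n)) (T : Finset (Fin n)) (p : ZMod 2)
    (J : Finset G.edgeSet) : Prop :=
  IsTJoin G T J ∧ (J.card : ZMod 2) = p

/-- `(T,p) ∈ 𝒯_G`: there exists a `(T,p)`-join. -/
def JoinExists (G : SimpleGraph (Fin n)) (T : Finset (Fin n)) (p : ZMod 2) : Prop :=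
  ∃ J : Finset G.edgeSet, IsTPJoin G T p J

/-- `J ∈ 𝒥(T,p)`: `J` is a `(T,p)`-join of minimum cardinality. -/
def IsMinJoin (G : SimpleGraph (Fin n)) (T : Finset (Fin n)) (p : ZMod 2)
    (J : Finset G.edgeSet) : Prop :=
  IsTPJoin G T p J ∧ ∀ J' : Finset G.edgeSet, IsTPJoin G T p J' → J.card ≤ J'.card

/-- The equivalence relation `∼` on minimum cardinality `(T,p)`-joins. -/
def JoinEquiv (G : SimpleGraph (Fin n)) (T : Finset (Fin n)) (p : ZMod 2)
    (J K : Finset G.edgeSet) : Prop :=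
  ∃ (r : ℕ) (L : ℕ → Finset G.edgeSet), L 0 = J ∧ L r = K ∧
    (∀ i ≤ r, IsMinJoin G T p (L i)) ∧ ∀ i < r, (L i ∩ L (i + 1)).Nonempty

/-- `(T,p) ∈ 𝒯_G*`: there are two nonequivalent minimum cardinality `(T,p)`-joins. -/
def TGstar (G : SimpleGraph (Fin n)) (T : Finset (Fin n)) (p : ZMod 2) : Prop :=
  ∃ J K : Finset G.edgeSet, IsMinJoin G T p J ∧ IsMinJoin G T p K ∧ ¬ JoinEquiv G T p J K

/-- `t_J`, the product of the variables indexed by the edges of `J`. -/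
noncomputable def tMon (K : Type*) [Field K] (G : SimpleGraph (Fin n))
    (J : Finset G.edgeSet) : MvPolynomial G.edgeSet K :=
  ∏ e ∈ J, X e

/-- The vertex set of a set of edges. -/
def edgeVerts (G : SimpleGraph (Fin n)) (C : Finset G.edgeSet) : Finset (Fin n) :=
  Finset.univ.filter fun i => ∃ e ∈ C, i ∈ e.val

/-- `C` is the edge set of a cycle of `G`. -/
def IsCycleSet (G : SimpleGraph (Fin n)) (C : Finset G.edgeSet) : Prop :=
  ∃ (v : Fin n) (w : G.Walk v v), w.IsCycle ∧
    C.image (fun e => e.val) = w.edges.toFinset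

/-- A chord of a cycle `C`: an edge of `G` joining two nonadjacent vertices of `C`. -/
def IsChord (G : SimpleGraph (Fin n)) (C : Finset G.edgeSet) (l : G.edgeSet) : Prop :=
  l ∉ C ∧ ∀ i ∈ l.val, i ∈ edgeVerts G C

/-- An even-chord of an even cardinality Eulerian set `C`. -/
def IsEvenChord (G : SimpleGraph (Fin n)) (C : Finset G.edgeSet) (l : G.edgeSet) : Prop :=
  l ∉ C ∧ ∃ C₁ C₂ : Finset G.edgeSet,
    IsEulerianSet G C₁ ∧ Even C₁.card ∧ IsEulerianSet G C₂ ∧ Even C₂.card ∧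
    C₁ ∩ C₂ = {l} ∧ C = symmDiff C₁ C₂

/-- `S` is a minimal homogeneous generating set of the ideal `I`. -/
def IsMinimalHomGenSet {σ K : Type*} [Field K] (S : Set (MvPolynomial σ K))
    (I : Ideal (MvPolynomial σ K)) : Prop :=
  (∀ f ∈ S, ∃ d : ℕ, f.IsHomogeneous d) ∧ Ideal.span S = I ∧
    ∀ f ∈ S, Ideal.span (S \ {f}) ≠ I


theorem edgeMono_eq_prod (K : Type*) [Field K] {e : Sym2 (Fin n)} (he : ¬ e.IsDiag) :
    edgeMono K e = ∏ i, if i ∈ e then X i else 1 := by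
  induction e using Sym2.ind with
  | _ a b =>
    rw [Finset.prod_ite, Finset.prod_const_one, mul_one]
    have h : (univ.filter fun i => i ∈ s(a, b)) = {a, b} := by ext; simp
    rw [h, Finset.prod_pair (by simpa using he)]
    rfl

theorem phiG_tMon (K : Type*) [Field K] (G : SimpleGraph (Fin n)) (J : Finset G.edgeSet) :
    phiG K G (tMon K G J) = ∏ i, X i ^ degIn G J i := by
  have h (e : G.edgeSet) : edgeMono K e.1 = ∏ i, if i ∈ e.1 then X i else 1 :=
    edgeMono_eq_prod K (G.not_isDiag_of_mem_edgeSet e.2)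
  simp only [tMon, phiG, map_prod, aeval_X, h]
  rw [Finset.prod_comm]
  refine Finset.prod_congr rfl fun i _ => ?_
  rw [Finset.prod_ite, Finset.prod_const_one, mul_one, Finset.prod_const, degIn]

theorem sum_degIn (G : SimpleGraph (Fin n)) (J : Finset G.edgeSet) :
    ∑ i, degIn G J i = 2 * J.card := by
  simp only [degIn, Finset.card_filter]
  rw [Finset.sum_comm, Finset.sum_const_nat (m := 2), mul_comm]
  intro e _
  rw [← Finset.card_filter, ← Sym2.card_toFinset_of_not_isDiag e.1
    (G.not_isDiag_of_mem_edgeSet e.2)]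
  congr 1
  ext
  simp

/-- Ring homomorphisms identifying all the squares `x_i²` send `φ(t^{2μ})` to a power of the
common value. -/
theorem map_phiG_monomial {K A : Type*} [Field K] [CommRing A] (G : SimpleGraph (Fin n))
    (ψ : MvPolynomial (Fin n) K →+* A) {s : A} (hs : ∀ i, ψ (X i) ^ 2 = s)
    (μ : G.edgeSet →₀ ℕ) :
    ψ (phiG K G (monomial (2 • μ) 1)) = s ^ (2 * μ.degree) := by
  have h (e : Sym2 (Fin n)) : ψ (edgeMono K e) ^ 2 = s ^ 2 := by
    induction e using Sym2.ind with
    | _ a b =>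
      change ψ (X a * X b) ^ 2 = _
      rw [map_mul, mul_pow, hs, hs, sq]
  have hm : monomial (2 • μ) (1 : K) = monomial μ 1 ^ 2 := by simp [monomial_pow]
  rw [hm, monomial_eq, C_1, one_mul, map_pow, map_pow, Finsupp.prod, map_prod, map_prod,
    ← Finset.prod_pow, pow_mul, Finsupp.degree_apply, ← Finset.prod_pow_eq_pow_sum]
  refine Finset.prod_congr rfl fun e _ => ?_
  rw [phiG, map_pow, aeval_X, map_pow, pow_right_comm, h]

theorem map_phiG_monomial_mul_tMon {K A : Type*} [Field K] [CommRing A]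
    (G : SimpleGraph (Fin n)) (ψ : MvPolynomial (Fin n) K →+* A) {s : A}
    (hs : ∀ i, ψ (X i) ^ 2 = s) (μ : G.edgeSet →₀ ℕ) (J : Finset G.edgeSet) :
    ψ (phiG K G (monomial (2 • μ) 1 * tMon K G J)) =
      s ^ (2 * μ.degree) * ∏ i, ψ (X i) ^ degIn G J i := by
  rw [map_mul, map_mul, map_phiG_monomial G ψ hs, phiG_tMon]
  simp

theorem totalDegree_monomial_mul_tMon (K : Type*) [Field K] (G : SimpleGraph (Fin n))
    (μ : G.edgeSet →₀ ℕ) (J : Finset G.edgeSet) :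
    (monomial (2 • μ) (1 : K) * tMon K G J).totalDegree = 2 * μ.degree + J.card := by
  have h : tMon K G J = monomial (∑ e ∈ J, Finsupp.single e 1) 1 := by
    rw [monomial_sum_one]
    rfl
  rw [h, monomial_mul, totalDegree_monomial _ (by simp)]
  change Finsupp.degree _ = _
  simp

/-- The homomorphism to a monoid algebra that records exponents modulo `2` together with the
total degree. -/
noncomputable def parityHom (K : Type*) [Field K] (n : ℕ) :
    MvPolynomial (Fin n) K →ₐ[K] MonoidAlgebra K (Multiplicative ((Fin n → ZMod 2) × ℕ)) :=
  aeval fun i => MonoidAlgebra.of K _ (Multiplicative.ofAdd (Pi.single i 1, 1))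

theorem parityHom_X_sq (K : Type*) [Field K] (i : Fin n) :
    parityHom K n (X i) ^ 2 = MonoidAlgebra.of K _ (Multiplicative.ofAdd (0, 2)) := by
  rw [parityHom, aeval_X, ← map_pow, ← ofAdd_nsmul]
  congr 2
  ext j
  · simp [CharTwo.two_eq_zero]
  · simp

theorem parityHom_phiG (K : Type*) [Field K] (G : SimpleGraph (Fin n))
    (μ : G.edgeSet →₀ ℕ) (J : Finset G.edgeSet) :
    parityHom K n (phiG K G (monomial (2 • μ) 1 * tMon K G J)) =
      MonoidAlgebra.of K _ (Multiplicative.ofAdd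
        ((fun i => (degIn G J i : ZMod 2)), 2 * (2 * μ.degree + J.card))) := by
  have h := map_phiG_monomial_mul_tMon G (parityHom K n).toRingHom (parityHom_X_sq K) μ J
  simp only [AlgHom.toRingHom_eq_coe, RingHom.coe_coe] at h
  rw [h]
  simp only [parityHom, aeval_X, ← map_pow, ← map_prod, ← map_mul, ← ofAdd_nsmul,
    ← ofAdd_sum, ← ofAdd_add]
  congr 2
  ext j
  · simp [Prod.fst_sum, Finset.sum_apply, Pi.single_apply]
  · simp [Prod.snd_sum, sum_degIn]
    ring

theorem parityHom_phiG_eq_zero (K : Type*) [Field K] (G : SimpleGraph (Fin n))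
    {f : MvPolynomial G.edgeSet K} (hf : f ∈ eulerianIdeal K G) :
    parityHom K n (phiG K G f) = 0 := by
  have h : Ideal.span {f | ∃ i j : Fin n, f = X i ^ 2 - X j ^ 2} ≤
      RingHom.ker (parityHom K n) := by
    rw [Ideal.span_le]
    rintro _ ⟨i, j, rfl⟩
    simp [RingHom.mem_ker, parityHom_X_sq]
  exact h hf

theorem prod_pow_eq_of_sq {A : Type*} [CommMonoid A] {y : Fin n → A} {s : A}
    (hs : ∀ i, y i ^ 2 = s) (d : Fin n → ℕ) :
    ∏ i, y i ^ d i = s ^ (∑ i, d i / 2) * ∏ i, y i ^ (d i % 2) := by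
  rw [← Finset.prod_pow_eq_pow_sum, ← Finset.prod_mul_distrib]
  refine Finset.prod_congr rfl fun i _ => ?_
  rw [← hs i, ← pow_mul, ← pow_add, Nat.div_add_mod]

theorem IsTJoin.eq_iff {G : SimpleGraph (Fin n)} {T₁ T₂ : Finset (Fin n)}
    {J K : Finset G.edgeSet} (hJ : IsTJoin G T₁ J) (hK : IsTJoin G T₂ K) :
    T₁ = T₂ ↔ ∀ i, degIn G J i % 2 = degIn G K i % 2 := by
  rw [Finset.ext_iff]
  refine forall_congr' fun i => ?_
  rw [hJ i, hK i, Nat.odd_iff, Nat.odd_iff]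
  omega

/-- for monomials `t^α = t^{2μ} t_J` and `t^β = t^{2ν} t_K`, where `J` is a
`(T₁,p₁)`-join and `K'` is a `(T₂,p₂)`-join, `t^α − t^β ∈ I(G)` iff `(T₁,p₁) = (T₂,p₂)`
and `t^α − t^β` is homogeneous, i.e. `deg t^α = deg t^β`. -/
theorem stmt1 {n : ℕ} (K : Type*) [Field K] (G : SimpleGraph (Fin n))
    (hE : 2 ≤ G.edgeSet.ncard)
    (μ ν : G.edgeSet →₀ ℕ) (J K' : Finset G.edgeSet)
    (T₁ T₂ : Finset (Fin n)) (p₁ p₂ : ZMod 2)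
    (hJ : IsTPJoin G T₁ p₁ J) (hK : IsTPJoin G T₂ p₂ K') :
    monomial (2 • μ) (1 : K) * tMon K G J - monomial (2 • ν) (1 : K) * tMon K G K'
        ∈ eulerianIdeal K G ↔
      (T₁ = T₂ ∧ p₁ = p₂) ∧
        (monomial (2 • μ) (1 : K) * tMon K G J).totalDegree =
          (monomial (2 • ν) (1 : K) * tMon K G K').totalDegree := by
  rw [totalDegree_monomial_mul_tMon, totalDegree_monomial_mul_tMon, hJ.1.eq_iff hK.1,
    ← hJ.2, ← hK.2]
  constructor
  · intro h
    have h := parityHom_phiG_eq_zero K G h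
    rw [map_sub, map_sub, sub_eq_zero, parityHom_phiG, parityHom_phiG] at h
    have h := Multiplicative.ofAdd.injective (MonoidAlgebra.of_injective h)
    rw [Prod.mk.injEq] at h
    have hd : 2 * μ.degree + #J = 2 * ν.degree + #K' := by omega
    refine ⟨⟨fun i => (ZMod.natCast_eq_natCast_iff' _ _ 2).1 (congrFun h.1 i), ?_⟩, hd⟩
    rw [ZMod.natCast_eq_natCast_iff']
    omega
  · rintro ⟨⟨hT, -⟩, hd⟩
    have hne : G.edgeSet.Nonempty := Set.nonempty_of_ncard_ne_zero (by omega)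
    obtain ⟨e, -⟩ := hne
    let v : Fin n := e.out.1
    rw [eulerianIdeal, Ideal.mem_comap, ← Ideal.Quotient.eq_zero_iff_mem, map_sub, map_sub,
      sub_eq_zero]
    have hs (i : Fin n) : Ideal.Quotient.mk
        (Ideal.span {f : MvPolynomial (Fin n) K | ∃ i j : Fin n, f = X i ^ 2 - X j ^ 2})
        (X i) ^ 2 = Ideal.Quotient.mk _ (X v ^ 2) := by
      rw [← map_pow]
      exact Ideal.Quotient.eq.2 (Ideal.subset_span ⟨i, v, rfl⟩)
    rw [map_phiG_monomial_mul_tMon G _ hs, map_phiG_monomial_mul_tMon G _ hs,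
      prod_pow_eq_of_sq hs (degIn G J), prod_pow_eq_of_sq hs (degIn G K'),
      ← mul_assoc, ← mul_assoc, ← pow_add, ← pow_add]
    have hsum (L : Finset G.edgeSet) :
        2 * ∑ i, degIn G L i / 2 + ∑ i, degIn G L i % 2 = 2 * #L := by
      rw [Finset.mul_sum, ← Finset.sum_add_distrib, ← sum_degIn]
      exact Finset.sum_congr rfl fun i _ => Nat.div_add_mod _ 2
    have h₁ := hsum J
    have h₂ := hsum K'
    simp only [hT] at h₁ ⊢
    congr 2
    omega
end

section
/- Let (T, p) ∈ 𝒯_G and let J be a (T,p)-join. Then J has minimum cardinality among all (T,p)-joins if and only if for every Eulerian subset C ⊆ E_G of even cardinality one has |J Δ C| ≥ |J|, equivalently |J ∩ C| ≤ |C|/2 (here Δ denotes symmetric difference). -/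
open MvPolynomial Finset

variable {n : ℕ}

/-- `|s Δ t| + 2 |s ∩ t| = |s| + |t|`. -/
theorem card_symmDiff_add_two_mul_card_inter {α : Type*} [DecidableEq α] (s t : Finset α) :
    (symmDiff s t).card + 2 * (s ∩ t).card = s.card + t.card := by
  have hd : (symmDiff s t).card = (s \ t).card + (t \ s).card :=
    Finset.card_union_of_disjoint disjoint_sdiff_sdiff
  have hs := Finset.card_sdiff_add_card_inter s t
  have ht := Finset.card_sdiff_add_card_inter t s
  rw [Finset.inter_comm t s] at ht
  omega

theorem degIn_symmDiff_add_two_mul_degIn_inter (G : SimpleGraph (Fin n))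
    [DecidableEq G.edgeSet] (J C : Finset G.edgeSet) (i : Fin n) :
    degIn G (symmDiff J C) i + 2 * degIn G (J ∩ C) i = degIn G J i + degIn G C i := by
  unfold degIn
  rw [← card_symmDiff_add_two_mul_card_inter, Finset.filter_inter_distrib]
  congr 2
  ext e
  simp only [Finset.mem_filter, Finset.mem_symmDiff]
  tauto

theorem IsTPJoin.symmDiff_isTPJoin {G : SimpleGraph (Fin n)} [DecidableEq G.edgeSet]
    {T : Finset (Fin n)} {p : ZMod 2} {J C : Finset G.edgeSet} (hJ : IsTPJoin G T p J)
    (hC : IsEulerianSet G C) (hCe : Even C.card) : IsTPJoin G T p (symmDiff J C) := by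
  refine ⟨fun i => ?_, ?_⟩
  · have h := degIn_symmDiff_add_two_mul_degIn_inter G J C i
    have hCi := hC i
    rw [hJ.1 i]
    grind
  · have h := card_symmDiff_add_two_mul_card_inter J C
    rw [← hJ.2, ZMod.natCast_eq_natCast_iff']
    grind

theorem IsTPJoin.isEulerianSet_symmDiff {G : SimpleGraph (Fin n)} [DecidableEq G.edgeSet]
    {T : Finset (Fin n)} {p : ZMod 2} {J J' : Finset G.edgeSet} (hJ : IsTPJoin G T p J)
    (hJ' : IsTPJoin G T p J') : IsEulerianSet G (symmDiff J J') := by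
  intro i
  have h := degIn_symmDiff_add_two_mul_degIn_inter G J J' i
  have hi := (hJ.1 i).symm.trans (hJ'.1 i)
  grind

theorem IsTPJoin.even_card_symmDiff {G : SimpleGraph (Fin n)} [DecidableEq G.edgeSet]
    {T : Finset (Fin n)} {p : ZMod 2} {J J' : Finset G.edgeSet} (hJ : IsTPJoin G T p J)
    (hJ' : IsTPJoin G T p J') : Even (symmDiff J J').card := by
  have h := card_symmDiff_add_two_mul_card_inter J J'
  have hp := (ZMod.natCast_eq_natCast_iff' _ _ _).1 (hJ.2.trans hJ'.2.symm)
  grind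

/-- a `(T,p)`-join `J` has minimum cardinality iff, for every Eulerian subset
`C ⊆ E_G` of even cardinality, `|J Δ C| ≥ |J|` and (equivalently) `|J ∩ C| ≤ |C|/2`. -/
theorem stmt2 {n : ℕ} (G : SimpleGraph (Fin n)) (hE : 2 ≤ G.edgeSet.ncard)
    (T : Finset (Fin n)) (p : ZMod 2) (hTp : JoinExists G T p)
    (J : Finset G.edgeSet) (hJ : IsTPJoin G T p J) :
    IsMinJoin G T p J ↔
      ∀ C : Finset G.edgeSet, IsEulerianSet G C → Even C.card →
        J.card ≤ (symmDiff J C).card ∧ 2 * (J ∩ C).card ≤ C.card := by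
  constructor
  · intro hmin C hC hCe
    have hle := hmin.2 _ (hJ.symmDiff_isTPJoin hC hCe)
    have h := card_symmDiff_add_two_mul_card_inter J C
    exact ⟨hle, by omega⟩
  · intro h
    refine ⟨hJ, fun J' hJ' => ?_⟩
    simpa using (h _ (hJ.isEulerianSet_symmDiff hJ') (hJ.even_card_symmDiff hJ')).1
end

section
/- Fix an ordering e₁, …, e_s of E_G and let B be the n × s incidence matrix of G (B_{ij} = 1 if vertex i belongs to edge e_j and B_{ij} = 0 otherwise). Then the Eulerian ideal I(G) equals the lattice ideal of the lattice 𝓛 = {θ ∈ ℤ^s : Bθ ∈ (2ℤ)^n and Σ_{j=1}^{s} θ_j = 0}, i.e. I(G) is generated by the binomials t^α − t^β with α, β ∈ ℕ^s and α − β ∈ 𝓛. -/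
open MvPolynomial Finset

variable {n : ℕ}

/-- A polynomial annihilated by a linear map that relabels monomials along `k` is a combination
of differences of monomials with the same label. -/
theorem mem_span_monomial_sub_of_map_eq_zero {τ M K : Type*} [Field K] (k : (τ →₀ ℕ) → M)
    (L : MvPolynomial τ K →ₗ[K] AddMonoidAlgebra K M)
    (hL : ∀ α c, L (monomial α c) = AddMonoidAlgebra.single (k α) c)
    {p : MvPolynomial τ K} (hp : L p = 0) :
    p ∈ Ideal.span {f : MvPolynomial τ K | ∃ α β : τ →₀ ℕ,
      k α = k β ∧ f = monomial α (1 : K) - monomial β (1 : K)} := by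
  set S := Ideal.span {f : MvPolynomial τ K | ∃ α β : τ →₀ ℕ,
      k α = k β ∧ f = monomial α (1 : K) - monomial β (1 : K)}
  let N : AddMonoidAlgebra K M →ₗ[K] MvPolynomial τ K :=
    Finsupp.linearCombination K (fun m => monomial (Function.invFun k m) (1 : K)) ∘ₗ
      (AddMonoidAlgebra.coeffLinearEquiv K).toLinearMap
  have key : ∀ q : MvPolynomial τ K, q - N (L q) ∈ S := by
    intro q
    induction q using MvPolynomial.induction_on' with
    | monomial α c =>
      have h : monomial α c - N (L (monomial α c)) =
          C c * (monomial α (1 : K) - monomial (Function.invFun k (k α)) (1 : K)) := by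
        simp [N, hL, mul_sub, C_mul_monomial, smul_monomial]
      rw [h]
      exact S.mul_mem_left _ (Ideal.subset_span
        ⟨α, _, (Function.invFun_eq ⟨α, rfl⟩).symm, rfl⟩)
    | add p q hp hq =>
      rw [map_add, map_add, add_sub_add_comm]
      exact S.add_mem hp hq
  simpa [hp] using key p

theorem prod_pow_eq_prod_pow_of_sq_eq {ι R : Type*} [Fintype ι] [CommMonoid R] {y : ι → R} {z : R}
    (h : ∀ i, y i ^ 2 = z) {a b : ι → ℕ} (hpar : ∀ i, a i % 2 = b i % 2)
    (hsum : ∑ i, a i = ∑ i, b i) : ∏ i, y i ^ a i = ∏ i, y i ^ b i := by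
  have key : ∀ c : ι → ℕ, ∏ i, y i ^ c i = (∏ i, y i ^ (c i % 2)) * z ^ ∑ i, c i / 2 := by
    intro c
    rw [← Finset.prod_pow_eq_pow_sum, ← Finset.prod_mul_distrib]
    refine Finset.prod_congr rfl fun i _ => ?_
    rw [← h i, ← pow_mul, ← pow_add, Nat.mod_add_div]
  have split : ∀ c : ι → ℕ, ∑ i, c i = ∑ i, c i % 2 + 2 * ∑ i, c i / 2 := by
    intro c
    rw [Finset.mul_sum, ← Finset.sum_add_distrib]
    exact Finset.sum_congr rfl fun i _ => (Nat.mod_add_div _ _).symm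
  have hhalf : ∑ i, a i / 2 = ∑ i, b i / 2 := by
    have ha := split a
    have hb := split b
    simp only [hpar] at ha
    omega
  rw [key, key b, hhalf]
  simp only [hpar]

/-- The degree of a monomial together with the parities of its exponents. -/
def parityDegree (n : ℕ) : (Fin n →₀ ℕ) →+ (Fin n → ZMod 2) × ℕ where
  toFun a := (fun i => (a i : ZMod 2), ∑ i, a i)
  map_zero' := by ext <;> simp
  map_add' a b := by ext <;> simp [Finset.sum_add_distrib]

theorem parityDegree_eq_iff {a b : Fin n →₀ ℕ} :
    parityDegree n a = parityDegree n b ↔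
      (∀ i, a i % 2 = b i % 2) ∧ ∑ i, a i = ∑ i, b i := by
  simp [parityDegree, funext_iff, ZMod.natCast_eq_natCast_iff', Prod.ext_iff]

theorem monomial_sub_mem_span_sq_sub_sq (K : Type*) [Field K] {a b : Fin n →₀ ℕ}
    (h : parityDegree n a = parityDegree n b) :
    monomial a (1 : K) - monomial b (1 : K) ∈
      Ideal.span {f : MvPolynomial (Fin n) K | ∃ i j : Fin n, f = X i ^ 2 - X j ^ 2} := by
  obtain ⟨hpar, hsum⟩ := parityDegree_eq_iff.1 h
  rcases isEmpty_or_nonempty (Fin n) with hn | ⟨⟨i₀⟩⟩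
  · rw [Subsingleton.elim a b, sub_self]
    exact Ideal.zero_mem _
  rw [← Ideal.Quotient.mk_eq_mk_iff_sub_mem]
  simp only [monomial_eq, map_one, one_mul]
  rw [Finsupp.prod_fintype _ _ (by simp), Finsupp.prod_fintype _ _ (by simp)]
  simp only [map_prod, map_pow]
  refine prod_pow_eq_prod_pow_of_sq_eq (z := Ideal.Quotient.mk _ (X i₀ ^ 2)) (fun i => ?_) hpar hsum
  rw [← map_pow, Ideal.Quotient.mk_eq_mk_iff_sub_mem]
  exact Ideal.subset_span ⟨i, i₀, rfl⟩

theorem mapDomain_parityDegree_eq_zero {K : Type*} [Field K] {p : MvPolynomial (Fin n) K}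
    (hp : p ∈ Ideal.span {f : MvPolynomial (Fin n) K | ∃ i j : Fin n, f = X i ^ 2 - X j ^ 2}) :
    AddMonoidAlgebra.mapDomainAlgHom K K (parityDegree n) p = 0 := by
  refine (Ideal.span_le (I := RingHom.ker
    (AddMonoidAlgebra.mapDomainAlgHom K K (parityDegree n)))).2 ?_ hp
  rintro _ ⟨i, j, rfl⟩
  have hkey : parityDegree n (Finsupp.single i 2) = parityDegree n (Finsupp.single j 2) := by
    rw [parityDegree_eq_iff]
    constructor
    · intro k
      rw [Finsupp.single_apply, Finsupp.single_apply]
      split_ifs <;> rfl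
    · simp [Finsupp.single_apply]
  rw [SetLike.mem_coe, RingHom.mem_ker, map_sub, sub_eq_zero, X_pow_eq_monomial,
    X_pow_eq_monomial]
  refine AddMonoidAlgebra.mapDomain_single.trans
    (Eq.trans ?_ AddMonoidAlgebra.mapDomain_single.symm)
  rw [hkey]

/-- The exponent vector of the squarefree monomial attached to an edge. -/
noncomputable def edgeExponent (e : Sym2 (Fin n)) : Fin n →₀ ℕ :=
  Finsupp.equivFunOnFinite.symm fun i => if i ∈ e then 1 else 0

theorem edgeExponent_mk {i j : Fin n} (h : i ≠ j) :
    edgeExponent s(i, j) = Finsupp.single i 1 + Finsupp.single j 1 := by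
  ext k
  simp only [edgeExponent, Finsupp.equivFunOnFinite_symm_apply_apply, Sym2.mem_iff,
    Finsupp.add_apply, Finsupp.single_apply]
  grind

theorem edgeMono_eq_monomial (K : Type*) [Field K] {e : Sym2 (Fin n)} (he : ¬ e.IsDiag) :
    edgeMono K e = monomial (edgeExponent e) 1 := by
  induction e with
  | _ i j =>
    rw [Sym2.mk_isDiag_iff] at he
    rw [edgeExponent_mk he, edgeMono, Sym2.lift_mk]
    simp [X, monomial_mul]

theorem sum_edgeExponent {e : Sym2 (Fin n)} (he : ¬ e.IsDiag) : ∑ i, edgeExponent e i = 2 := by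
  induction e with
  | _ i j =>
    rw [Sym2.mk_isDiag_iff] at he
    simp [edgeExponent_mk he, Finset.sum_add_distrib, Finsupp.single_apply]

theorem phiG_rename_monomial (K : Type*) [Field K] (G : SimpleGraph (Fin n)) {s : ℕ}
    (σ : Fin s → G.edgeSet) (α : Fin s →₀ ℕ) (c : K) :
    phiG K G (rename σ (monomial α c)) =
      monomial (∑ j, α j • edgeExponent (σ j).val) c := by
  rw [phiG, aeval_rename, aeval_monomial, Finsupp.prod_fintype _ _ (by simp),
    ← mul_one c, ← C_mul_monomial, mul_one, monomial_sum_one]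
  congr 1
  refine Finset.prod_congr rfl fun j _ => ?_
  rw [Function.comp_apply, edgeMono_eq_monomial K (G.not_isDiag_of_mem_edgeSet (σ j).2),
    monomial_pow, one_pow]

theorem parityDegree_sum_edgeExponent_eq_iff (G : SimpleGraph (Fin n)) {s : ℕ}
    (σ : Fin s → G.edgeSet) (B : Matrix (Fin n) (Fin s) ℤ)
    (hB : ∀ i j, B i j = if i ∈ (σ j).val then 1 else 0) (α β : Fin s →₀ ℕ) :
    parityDegree n (∑ j, α j • edgeExponent (σ j).val) =
        parityDegree n (∑ j, β j • edgeExponent (σ j).val) ↔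
      (∀ i : Fin n, (2 : ℤ) ∣ ∑ j : Fin s, B i j * ((α j : ℤ) - (β j : ℤ))) ∧
        (∑ j : Fin s, ((α j : ℤ) - (β j : ℤ))) = 0 := by
  have hdeg : ∀ γ : Fin s →₀ ℕ,
      ∑ i, (∑ j, γ j • edgeExponent (σ j).val) i = 2 * ∑ j, γ j := by
    intro γ
    simp only [Finsupp.finsetSum_apply, Finsupp.smul_apply, smul_eq_mul]
    rw [Finset.sum_comm, Finset.mul_sum]
    refine Finset.sum_congr rfl fun j _ => ?_
    rw [← Finset.mul_sum, sum_edgeExponent (G.not_isDiag_of_mem_edgeSet (σ j).2), mul_comm]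
  have hcoord : ∀ (γ : Fin s →₀ ℕ) (i : Fin n),
      (((∑ j, γ j • edgeExponent (σ j).val) i : ℕ) : ℤ) = ∑ j, B i j * (γ j : ℤ) := by
    intro γ i
    simp only [Finsupp.finsetSum_apply, Finsupp.smul_apply, smul_eq_mul, Nat.cast_sum,
      Nat.cast_mul, hB, edgeExponent, Finsupp.equivFunOnFinite_symm_apply_apply, Nat.cast_ite,
      Nat.cast_one, Nat.cast_zero, mul_comm]
  rw [parityDegree_eq_iff, hdeg, hdeg]
  refine and_congr (forall_congr' fun i => ?_) ?_
  · simp only [mul_sub, Finset.sum_sub_distrib, ← hcoord]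
    omega
  · rw [Finset.sum_sub_distrib, ← Nat.cast_sum, ← Nat.cast_sum]
    omega

/-- with respect to an ordering `e₁, …, e_s` of `E_G`, and with `B` the
incidence matrix of `G`, the Eulerian ideal `I(G)` is the lattice ideal of the lattice
`𝓛 = {θ ∈ ℤ^s : Bθ ∈ (2ℤ)^n and Σ θ_j = 0}`, i.e. it is generated by the binomials
`t^α − t^β` with `α, β ∈ ℕ^s` and `α − β ∈ 𝓛`. -/
theorem stmt3 {n s : ℕ} (K : Type*) [Field K] (G : SimpleGraph (Fin n))
    (hE : 2 ≤ G.edgeSet.ncard) (hs : s = G.edgeSet.ncard)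
    (σ : Fin s ≃ G.edgeSet) (B : Matrix (Fin n) (Fin s) ℤ)
    (hB : ∀ i j, B i j = if i ∈ (σ j).val then 1 else 0) :
    eulerianIdeal K G =
      Ideal.map (rename (⇑σ) : MvPolynomial (Fin s) K →ₐ[K] MvPolynomial G.edgeSet K)
        (Ideal.span {f : MvPolynomial (Fin s) K | ∃ α β : Fin s →₀ ℕ,
          (∀ i : Fin n, (2 : ℤ) ∣ ∑ j : Fin s, B i j * ((α j : ℤ) - (β j : ℤ))) ∧
          (∑ j : Fin s, ((α j : ℤ) - (β j : ℤ))) = 0 ∧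
          f = monomial α (1 : K) - monomial β (1 : K)}) := by
  have hset : {f : MvPolynomial (Fin s) K | ∃ α β : Fin s →₀ ℕ,
      parityDegree n (∑ j, α j • edgeExponent (σ j).val) =
        parityDegree n (∑ j, β j • edgeExponent (σ j).val) ∧
      f = monomial α (1 : K) - monomial β (1 : K)} =
      {f : MvPolynomial (Fin s) K | ∃ α β : Fin s →₀ ℕ,
        (∀ i : Fin n, (2 : ℤ) ∣ ∑ j : Fin s, B i j * ((α j : ℤ) - (β j : ℤ))) ∧
        (∑ j : Fin s, ((α j : ℤ) - (β j : ℤ))) = 0 ∧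
        f = monomial α (1 : K) - monomial β (1 : K)} := by
    simp only [parityDegree_sum_edgeExponent_eq_iff G σ B hB, and_assoc]
  rw [← hset]
  apply le_antisymm
  · intro p hp
    obtain ⟨q, rfl⟩ := rename_surjective (R := K) σ σ.surjective p
    refine Ideal.mem_map_of_mem _ ?_
    refine mem_span_monomial_sub_of_map_eq_zero _
      ((AddMonoidAlgebra.mapDomainAlgHom K K (parityDegree n)).toLinearMap ∘ₗ
        ((phiG K G).comp (rename σ)).toLinearMap) (fun α c => ?_)
      (mapDomain_parityDegree_eq_zero hp)
    simp only [LinearMap.comp_apply, AlgHom.toLinearMap_apply, AlgHom.comp_apply,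
      phiG_rename_monomial]
    exact AddMonoidAlgebra.mapDomain_single
  · rw [Ideal.map_le_iff_le_comap, Ideal.span_le]
    rintro _ ⟨α, β, h, rfl⟩
    rw [SetLike.mem_coe, Ideal.mem_comap, eulerianIdeal, Ideal.mem_comap, map_sub, map_sub,
      phiG_rename_monomial, phiG_rename_monomial]
    exact monomial_sub_mem_span_sq_sub_sq K h
end

section
/- A nonzero homogeneous binomial f of degree d in I(G) does not belong to the ideal generated by the elements of I(G) of degree less than d if and only if f is either of the form t_e² − t_ℓ² for some distinct edges e, ℓ ∈ E_G, or of the form t_J − t_K, where J and K are nonequivalent minimum cardinality (T,p)-joins for some pair (T,p) ∈ 𝒯_G. -/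
open MvPolynomial Finset

variable {n : ℕ}

section EulerianMembership

/-- The exponent vector of the squarefree monomial supported on the endpoints of `e`. -/
noncomputable def edgeExp (e : Sym2 (Fin n)) : Fin n →₀ ℕ :=
  Finsupp.equivFunOnFinite.symm fun i => if i ∈ e then 1 else 0

theorem edgeExp_apply (e : Sym2 (Fin n)) (i : Fin n) :
    edgeExp e i = if i ∈ e then 1 else 0 := rfl

theorem edgeExp_mk {i j : Fin n} (h : i ≠ j) :
    edgeExp s(i, j) = Finsupp.single i 1 + Finsupp.single j 1 := by
  ext k
  simp only [edgeExp_apply, Sym2.mem_iff, Finsupp.add_apply, Finsupp.single_apply]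
  grind

/-- The exponent vector of the image of a monomial of `K[E_G]` under `φ`. -/
noncomputable def vertexExp (G : SimpleGraph (Fin n)) : (G.edgeSet →₀ ℕ) →+ (Fin n →₀ ℕ) :=
  Finsupp.liftAddHom fun e => multiplesHom _ (edgeExp e.1)

/-- Reduction of an exponent vector modulo two. -/
def expParity (n : ℕ) : (Fin n →₀ ℕ) →+ (Fin n → ZMod 2) where
  toFun u i := u i
  map_zero' := by ext; simp
  map_add' u v := by ext; simp

theorem expParity_apply (u : Fin n →₀ ℕ) (i : Fin n) : expParity n u i = (u i : ZMod 2) := rfl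

/-- The vertex degrees modulo two of a multiset of edges. -/
noncomputable def edgeParity (G : SimpleGraph (Fin n)) :
    (G.edgeSet →₀ ℕ) →+ (Fin n → ZMod 2) :=
  (expParity n).comp (vertexExp G)

variable {G : SimpleGraph (Fin n)}

theorem vertexExp_single (e : G.edgeSet) (k : ℕ) :
    vertexExp G (Finsupp.single e k) = k • edgeExp e.1 := by
  simp [vertexExp]

theorem edgeParity_single (e : G.edgeSet) (k : ℕ) (i : Fin n) :
    edgeParity G (Finsupp.single e k) i = k * if i ∈ e.1 then 1 else 0 := by
  simp [edgeParity, vertexExp_single, expParity_apply, edgeExp_apply]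

theorem edgeParity_two_nsmul (γ : G.edgeSet →₀ ℕ) : edgeParity G (2 • γ) = 0 := by
  ext i
  rw [map_nsmul]
  simp [show (2 : ZMod 2) = 0 from rfl]

theorem edgeExp_coe (e : G.edgeSet) :
    ∃ i j : Fin n, e.1 = s(i, j) ∧ edgeExp e.1 = Finsupp.single i 1 + Finsupp.single j 1 := by
  obtain ⟨e, he⟩ := e
  induction e using Sym2.ind with
  | _ i j => exact ⟨i, j, rfl, edgeExp_mk (G.ne_of_adj he)⟩

theorem degree_vertexExp (γ : G.edgeSet →₀ ℕ) : (vertexExp G γ).degree = 2 * γ.degree := by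
  induction γ using Finsupp.induction_linear with
  | zero => simp
  | add f g hf hg => simp [hf, hg, mul_add]
  | single e k =>
    obtain ⟨i, j, -, h⟩ := edgeExp_coe e
    rw [vertexExp_single, h, map_nsmul, map_add]
    simp only [Finsupp.degree_single, smul_eq_mul]
    ring

theorem phiG_monomial (K : Type*) [Field K] (γ : G.edgeSet →₀ ℕ) :
    phiG K G (monomial γ 1) = monomial (vertexExp G γ) 1 := by
  induction γ using Finsupp.induction_linear with
  | zero => simp
  | add f g hf hg =>
    rw [← one_mul (1 : K), ← monomial_mul, map_mul, hf, hg, monomial_mul, map_add]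
  | single e k =>
    obtain ⟨i, j, hij, h⟩ := edgeExp_coe e
    have hX : phiG K G (X e) = monomial (edgeExp e.1) 1 := by
      rw [h, phiG, aeval_X, hij, ← one_mul (1 : K), ← monomial_mul]
      rfl
    rw [vertexExp_single, ← X_pow_eq_monomial, map_pow, hX, monomial_pow, one_pow]

theorem monomial_sub_monomial_mem_span (K : Type*) [Field K] {u v : Fin n →₀ ℕ}
    (hd : u.degree = v.degree) (hp : expParity n u = expParity n v) :
    (monomial u 1 - monomial v 1 : MvPolynomial (Fin n) K) ∈
      Ideal.span {f : MvPolynomial (Fin n) K | ∃ i j : Fin n, f = X i ^ 2 - X j ^ 2} := by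
  set I := Ideal.span {f : MvPolynomial (Fin n) K | ∃ i j : Fin n, f = X i ^ 2 - X j ^ 2}
  rcases isEmpty_or_nonempty (Fin n) with h | ⟨⟨i₀⟩⟩
  · simp [Subsingleton.elim u v]
  have hsq (i : Fin n) : Ideal.Quotient.mk I (X i) ^ 2 = Ideal.Quotient.mk I (X i₀) ^ 2 := by
    rw [← map_pow, ← map_pow, Ideal.Quotient.eq]
    exact Ideal.subset_span ⟨i, i₀, rfl⟩
  have hred (w : Fin n →₀ ℕ) : Ideal.Quotient.mk I (monomial w 1) =
      (Ideal.Quotient.mk I (X i₀) ^ 2) ^ (∑ i, w i / 2) *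
        ∏ i, Ideal.Quotient.mk I (X i) ^ (w i % 2) := by
    rw [monomial_eq, Finsupp.prod_fintype _ _ (by simp), ← Finset.prod_pow_eq_pow_sum,
      ← Finset.prod_mul_distrib]
    simp only [map_one, one_mul, map_prod, map_pow]
    refine Finset.prod_congr rfl fun i _ => ?_
    rw [← hsq i, ← pow_mul, ← pow_add, Nat.div_add_mod]
  have hmod (i : Fin n) : u i % 2 = v i % 2 :=
    (ZMod.natCast_eq_natCast_iff' _ _ 2).1 (congrFun hp i)
  have hdiv : ∑ i, u i / 2 = ∑ i, v i / 2 := by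
    have key (w : Fin n →₀ ℕ) : w.degree = 2 * ∑ i, w i / 2 + ∑ i, w i % 2 := by
      rw [Finsupp.degree_eq_sum, Finset.mul_sum, ← Finset.sum_add_distrib]
      exact Finset.sum_congr rfl fun i _ => (Nat.div_add_mod _ _).symm
    have hu := key u
    have hv := key v
    simp only [hmod] at hu
    omega
  rw [← Ideal.Quotient.eq, hred, hred, hdiv]
  simp only [hmod]

theorem monomial_sub_monomial_mem_eulerianIdeal (K : Type*) [Field K] {α β : G.edgeSet →₀ ℕ}
    (hd : α.degree = β.degree) (hp : edgeParity G α = edgeParity G β) :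
    (monomial α 1 - monomial β 1 : MvPolynomial G.edgeSet K) ∈ eulerianIdeal K G := by
  rw [eulerianIdeal, Ideal.mem_comap, map_sub, phiG_monomial, phiG_monomial]
  exact monomial_sub_monomial_mem_span K (by simp [degree_vertexExp, hd]) hp

/-- The grading of `K[x_1,…,x_n]` by total degree and degrees modulo two, as an algebra map. -/
noncomputable def parityGrading (K : Type*) [Field K] (n : ℕ) :
    MvPolynomial (Fin n) K →ₐ[K] AddMonoidAlgebra K (ℕ × (Fin n → ZMod 2)) :=
  aeval fun i => AddMonoidAlgebra.single (1, expParity n (Finsupp.single i 1)) 1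

theorem parityGrading_monomial (K : Type*) [Field K] (u : Fin n →₀ ℕ) :
    parityGrading K n (monomial u 1) = AddMonoidAlgebra.single (u.degree, expParity n u) 1 := by
  induction u using Finsupp.induction_linear with
  | zero =>
    rw [map_zero, map_zero]
    exact map_one _
  | add f g hf hg =>
    rw [← one_mul (1 : K), ← monomial_mul, map_mul, hf, hg, AddMonoidAlgebra.single_mul_single]
    simp
  | single i k =>
    rw [parityGrading, aeval_monomial, map_one, one_mul, Finsupp.prod_single_index (by simp),
      AddMonoidAlgebra.single_pow, Prod.smul_mk, ← map_nsmul, one_pow, Finsupp.smul_single]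
    simp

theorem parityGrading_phiG_eq_zero {K : Type*} [Field K] {g : MvPolynomial G.edgeSet K}
    (hg : g ∈ eulerianIdeal K G) : parityGrading K n (phiG K G g) = 0 := by
  have : Ideal.span {f : MvPolynomial (Fin n) K | ∃ i j : Fin n, f = X i ^ 2 - X j ^ 2} ≤
      RingHom.ker (parityGrading K n) := by
    rw [Ideal.span_le]
    rintro _ ⟨i, j, rfl⟩
    have h (i : Fin n) : expParity n (Finsupp.single i 2) = 0 := by
      ext k
      by_cases h : i = k
      · subst h
        simp only [expParity_apply, Finsupp.single_eq_same]
        rfl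
      · simp [expParity_apply, h]
    simp [X_pow_eq_monomial, parityGrading_monomial, h]
  exact this hg

theorem parityGrading_phiG_monomial (K : Type*) [Field K] (γ : G.edgeSet →₀ ℕ) :
    parityGrading K n (phiG K G (monomial γ 1)) =
      AddMonoidAlgebra.single (2 * γ.degree, edgeParity G γ) 1 := by
  rw [phiG_monomial, parityGrading_monomial, degree_vertexExp]
  rfl

theorem edgeParity_eq_of_sub_mem {K : Type*} [Field K] {α β : G.edgeSet →₀ ℕ}
    (h : (monomial α 1 - monomial β 1 : MvPolynomial G.edgeSet K) ∈ eulerianIdeal K G) :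
    edgeParity G α = edgeParity G β := by
  have := parityGrading_phiG_eq_zero h
  rw [map_sub, map_sub, parityGrading_phiG_monomial, parityGrading_phiG_monomial, sub_eq_zero,
    AddMonoidAlgebra.single_left_inj one_ne_zero] at this
  exact (Prod.ext_iff.1 this).2

open Classical in
/-- The sum of the coefficients of a polynomial over the exponents in `C`. -/
noncomputable def coeffSum {σ : Type*} (K : Type*) [Field K] (C : Set (σ →₀ ℕ)) :
    MvPolynomial σ K →ₗ[K] K :=
  (basisMonomials σ K).constr K fun γ => if γ ∈ C then 1 else 0

open Classical in
theorem coeffSum_monomial {σ : Type*} (K : Type*) [Field K] (C : Set (σ →₀ ℕ)) (γ : σ →₀ ℕ) :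
    coeffSum K C (monomial γ 1) = if γ ∈ C then 1 else 0 := by
  rw [coeffSum, ← congrFun (coe_basisMonomials σ K) γ, Module.Basis.constr_basis]

theorem coeffSum_eq_zero_of_disjoint {σ K : Type*} [Field K] {C : Set (σ →₀ ℕ)} {g : MvPolynomial σ K}
    (h : ∀ γ ∈ g.support, γ ∉ C) : coeffSum K C g = 0 := by
  rw [g.as_sum, map_sum]
  refine Finset.sum_eq_zero fun γ hγ => ?_
  rw [← mul_one (coeff γ g), ← smul_eq_mul, ← smul_monomial, map_smul, coeffSum_monomial,
    if_neg (h γ hγ), smul_zero]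

theorem coeffSum_monomial_mul {σ : Type*} (K : Type*) [Field K] (C : Set (σ →₀ ℕ))
    (m : σ →₀ ℕ) (g : MvPolynomial σ K) :
    coeffSum K C (monomial m 1 * g) = coeffSum K {γ | m + γ ∈ C} g := by
  suffices coeffSum K C ∘ₗ LinearMap.mulLeft K (monomial m 1) = coeffSum K {γ | m + γ ∈ C} from
    LinearMap.congr_fun this g
  refine (basisMonomials σ K).ext fun γ => ?_
  simp [coeffSum_monomial]

theorem coeffSum_parityClass_eq_zero {K : Type*} [Field K] {g : MvPolynomial G.edgeSet K}
    (hg : g ∈ eulerianIdeal K G) (k : ℕ) (q : Fin n → ZMod 2) :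
    coeffSum K {γ | γ.degree = k ∧ edgeParity G γ = q} g = 0 := by
  suffices coeffSum K {γ | γ.degree = k ∧ edgeParity G γ = q} =
      Finsupp.lapply (2 * k, q) ∘ₗ (AddMonoidAlgebra.coeffLinearEquiv K).toLinearMap ∘ₗ
        (parityGrading K n).toLinearMap ∘ₗ (phiG K G).toLinearMap by
    rw [this]
    simp [parityGrading_phiG_eq_zero hg]
  refine (basisMonomials G.edgeSet K).ext fun γ => ?_
  simp [coeffSum_monomial, parityGrading_phiG_monomial, Finsupp.single_apply]

/-- The ideal generated by the elements of the Eulerian ideal of degree less than `d`. -/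
noncomputable def lowDegreeIdeal (K : Type*) [Field K] (G : SimpleGraph (Fin n)) (d : ℕ) :
    Ideal (MvPolynomial G.edgeSet K) :=
  Ideal.span {g | g ∈ eulerianIdeal K G ∧ g.totalDegree < d}

/-- A set of exponents of degree `d` and fixed parity that is stable under passing to an
exponent of the same degree and parity sharing a variable. -/
structure IsLinkClosed (G : SimpleGraph (Fin n)) (d : ℕ) (q : Fin n → ZMod 2)
    (C : Set (G.edgeSet →₀ ℕ)) : Prop where
  degree_eq : ∀ γ ∈ C, γ.degree = d
  parity_eq : ∀ γ ∈ C, edgeParity G γ = q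
  mem_of_link : ∀ γ ∈ C, ∀ δ : G.edgeSet →₀ ℕ, δ.degree = d → edgeParity G δ = q →
    (∃ e, γ e ≠ 0 ∧ δ e ≠ 0) → δ ∈ C

theorem IsLinkClosed.coeffSum_eq_zero {K : Type*} [Field K] {d : ℕ} {q : Fin n → ZMod 2}
    {C : Set (G.edgeSet →₀ ℕ)} (hC : IsLinkClosed G d q C) {g : MvPolynomial G.edgeSet K}
    (hg : g ∈ lowDegreeIdeal K G d) : coeffSum K C g = 0 := by
  induction hg using Submodule.closure_induction with
  | zero => simp
  | add x y _ _ hx hy => simp [hx, hy]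
  | smul_mem r x hx =>
    obtain ⟨hx, hdeg⟩ := hx
    suffices coeffSum K C ∘ₗ LinearMap.mulRight K x = 0 from LinearMap.congr_fun this r
    refine (basisMonomials G.edgeSet K).ext fun m => ?_
    simp only [coe_basisMonomials, LinearMap.comp_apply, LinearMap.mulRight_apply,
      coeffSum_monomial_mul, LinearMap.zero_apply]
    by_cases hm : m = 0
    · refine coeffSum_eq_zero_of_disjoint fun γ hγ hγC => ?_
      have h₁ := hC.degree_eq _ hγC
      have h₂ := le_totalDegree hγ
      rw [hm, zero_add, Finsupp.degree_apply] at h₁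
      exact absurd hdeg (not_lt.2 (h₁ ▸ h₂))
    by_cases hne : ∃ γ₀, m + γ₀ ∈ C
    · obtain ⟨γ₀, hγ₀⟩ := hne
      obtain ⟨e, he⟩ := Finsupp.ne_iff.1 hm
      rw [Finsupp.zero_apply] at he
      rw [← coeffSum_parityClass_eq_zero hx γ₀.degree (edgeParity G γ₀)]
      congr 2
      refine Set.ext fun γ => ?_
      have hd := hC.degree_eq _ hγ₀
      have hq := hC.parity_eq _ hγ₀
      rw [map_add] at hd hq
      constructor
      · intro hγ
        have hd' := hC.degree_eq _ hγ
        have hq' := hC.parity_eq _ hγ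
        rw [map_add] at hd' hq'
        exact ⟨by omega, add_left_cancel (hq'.trans hq.symm)⟩
      · rintro ⟨h₁, h₂⟩
        exact hC.mem_of_link _ hγ₀ _ (by rw [map_add, h₁, hd]) (by rw [map_add, h₂, hq])
          ⟨e, by simp [he], by simp [he]⟩
    · exact coeffSum_eq_zero_of_disjoint fun γ _ hγC => hne ⟨γ, hγC⟩

theorem monomial_sub_mem_lowDegreeIdeal (K : Type*) [Field K] {α β : G.edgeSet →₀ ℕ}
    (hd : α.degree = β.degree) (hp : edgeParity G α = edgeParity G β)
    (h : ∃ e, α e ≠ 0 ∧ β e ≠ 0) :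
    (monomial α 1 - monomial β 1 : MvPolynomial G.edgeSet K) ∈ lowDegreeIdeal K G α.degree := by
  obtain ⟨e, hα, hβ⟩ := h
  obtain ⟨a, rfl⟩ := exists_add_of_le (Finsupp.single_le_iff.2 (Nat.one_le_iff_ne_zero.2 hα))
  obtain ⟨b, rfl⟩ := exists_add_of_le (Finsupp.single_le_iff.2 (Nat.one_le_iff_ne_zero.2 hβ))
  rw [map_add, map_add] at hd hp
  have hd' := add_left_cancel hd
  rw [← one_mul (1 : K), ← monomial_mul, ← monomial_mul, ← mul_sub]
  refine Ideal.mul_mem_left _ _ (Ideal.subset_span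
    ⟨monomial_sub_monomial_mem_eulerianIdeal K hd' (add_left_cancel hp), ?_⟩)
  refine (totalDegree_sub _ _).trans_lt ?_
  rw [totalDegree_monomial _ one_ne_zero, totalDegree_monomial _ one_ne_zero,
    map_add, Finsupp.degree_single]
  change max a.degree b.degree < _
  omega

/-- Two monomials lying in the same coset of `lowDegreeIdeal K G d`. -/
def LowCongruent (K : Type*) [Field K] (G : SimpleGraph (Fin n)) (d : ℕ)
    (α β : G.edgeSet →₀ ℕ) : Prop :=
  (monomial α 1 - monomial β 1 : MvPolynomial G.edgeSet K) ∈ lowDegreeIdeal K G d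

theorem LowCongruent.refl (K : Type*) [Field K] (d : ℕ) (α : G.edgeSet →₀ ℕ) :
    LowCongruent K G d α α := by
  simp [LowCongruent]

theorem LowCongruent.symm {K : Type*} [Field K] {d : ℕ} {α β : G.edgeSet →₀ ℕ}
    (h : LowCongruent K G d α β) : LowCongruent K G d β α := by
  rw [LowCongruent, ← neg_sub]
  exact neg_mem h

theorem LowCongruent.trans {K : Type*} [Field K] {d : ℕ} {α β γ : G.edgeSet →₀ ℕ}
    (h : LowCongruent K G d α β) (h' : LowCongruent K G d β γ) : LowCongruent K G d α γ := by
  rw [LowCongruent, ← sub_add_sub_cancel]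
  exact add_mem h h'

theorem exists_ne_zero_of_degree_ne_zero {σ : Type*} {γ : σ →₀ ℕ} (h : γ.degree ≠ 0) :
    ∃ e, γ e ≠ 0 := by
  rw [Ne, Finsupp.degree_eq_zero_iff] at h
  exact Finsupp.ne_iff.1 h

theorem lowCongruent_of_two_le (K : Type*) [Field K] {α β : G.edgeSet →₀ ℕ}
    (hd : α.degree = β.degree) (hp : edgeParity G α = edgeParity G β) (hd2 : α.degree ≠ 2)
    {e : G.edgeSet} (he : 2 ≤ α e) : LowCongruent K G α.degree α β := by
  obtain ⟨γ, rfl⟩ := exists_add_of_le (Finsupp.single_le_iff.2 he)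
  have hdeg : (Finsupp.single e 2 + γ).degree = 2 + γ.degree := by simp
  obtain ⟨l, hl⟩ := exists_ne_zero_of_degree_ne_zero (γ := β) (by omega)
  obtain ⟨m, hm⟩ := exists_ne_zero_of_degree_ne_zero (γ := γ) (by omega)
  have hpar (a : G.edgeSet) : edgeParity G (Finsupp.single a 2) = 0 := by
    simpa using edgeParity_two_nsmul (Finsupp.single a 1)
  have hdeg' : (Finsupp.single l 2 + γ).degree = (Finsupp.single e 2 + γ).degree := by simp
  have h₁ := monomial_sub_mem_lowDegreeIdeal K (G := G) (α := Finsupp.single e 2 + γ)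
    (β := Finsupp.single l 2 + γ) hdeg'.symm (by simp [hpar]) ⟨m, by simp [hm], by simp [hm]⟩
  have h₂ := monomial_sub_mem_lowDegreeIdeal K (G := G) (α := Finsupp.single l 2 + γ) (β := β)
    (hdeg'.trans hd) (by rw [← hp]; simp [hpar]) ⟨l, by simp, hl⟩
  rw [hdeg'] at h₂
  exact LowCongruent.trans h₁ h₂

theorem eq_single_of_degree_two {γ : G.edgeSet →₀ ℕ} (hd : γ.degree = 2)
    (hp : edgeParity G γ = 0) : ∃ e, γ = Finsupp.single e 2 := by
  obtain ⟨a, ha⟩ := exists_ne_zero_of_degree_ne_zero (γ := γ) (by omega)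
  obtain ⟨γ, rfl⟩ := exists_add_of_le (Finsupp.single_le_iff.2 (Nat.one_le_iff_ne_zero.2 ha))
  rw [map_add, Finsupp.degree_single] at hd
  obtain ⟨b, hb⟩ := exists_ne_zero_of_degree_ne_zero (γ := γ) (by omega)
  obtain ⟨γ, rfl⟩ := exists_add_of_le (Finsupp.single_le_iff.2 (Nat.one_le_iff_ne_zero.2 hb))
  rw [map_add, Finsupp.degree_single] at hd
  obtain rfl : γ = 0 := (Finsupp.degree_eq_zero_iff γ).1 (by omega)
  rw [add_zero] at hp ⊢
  suffices a = b by
    subst this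
    exact ⟨a, by rw [← Finsupp.single_add]⟩
  refine Subtype.ext (Sym2.ext fun i => ?_)
  have := congrFun hp i
  rw [map_add, Pi.add_apply, edgeParity_single, edgeParity_single] at this
  by_cases h₁ : i ∈ a.1 <;> by_cases h₂ : i ∈ b.1 <;> simp [h₁, h₂] at this ⊢

/-- The exponent vector of the squarefree monomial `t_J`. -/
noncomputable def setExp (J : Finset G.edgeSet) : G.edgeSet →₀ ℕ :=
  ∑ e ∈ J, Finsupp.single e 1

theorem tMon_eq_monomial (K : Type*) [Field K] (J : Finset G.edgeSet) :
    tMon K G J = monomial (setExp J) 1 := by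
  rw [setExp, monomial_sum_one]
  rfl

theorem degree_setExp (J : Finset G.edgeSet) : (setExp J).degree = #J := by
  simp [setExp]

theorem edgeParity_setExp (J : Finset G.edgeSet) (i : Fin n) :
    edgeParity G (setExp J) i = degIn G J i := by
  rw [setExp, map_sum, Finset.sum_apply]
  simp only [edgeParity_single, degIn, Nat.cast_one, one_mul]
  simp

open Classical in
theorem setExp_apply (J : Finset G.edgeSet) (e : G.edgeSet) :
    setExp J e = if e ∈ J then 1 else 0 := by
  simp [setExp, Finsupp.finsetSum_apply, Finsupp.single_apply]

theorem setExp_ne_zero {J : Finset G.edgeSet} {e : G.edgeSet} : setExp J e ≠ 0 ↔ e ∈ J := by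
  simp [setExp_apply]

theorem setExp_injective : Function.Injective (setExp (G := G)) := fun J K h => by
  ext e
  rw [← setExp_ne_zero, h, setExp_ne_zero]

theorem setExp_support {γ : G.edgeSet →₀ ℕ} (h : ∀ e, γ e < 2) : setExp γ.support = γ := by
  ext e
  have := h e
  rw [setExp_apply]
  split_ifs with h' <;> rw [Finsupp.mem_support_iff] at h' <;> omega

/-- Every exponent vector is a squarefree one plus an even one. -/
theorem exists_setExp_add (γ : G.edgeSet →₀ ℕ) :
    ∃ (J : Finset G.edgeSet) (h : G.edgeSet →₀ ℕ), γ = setExp J + 2 • h := by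
  refine ⟨(γ.mapRange (· % 2) rfl).support, γ.mapRange (· / 2) rfl, ?_⟩
  rw [setExp_support fun e => by simpa using Nat.mod_lt _ two_pos]
  ext e
  simpa using (Nat.mod_add_div _ _).symm

/-- The parity vector of a vertex set. -/
def setParity (T : Finset (Fin n)) (i : Fin n) : ZMod 2 := if i ∈ T then 1 else 0

theorem isTPJoin_iff {T : Finset (Fin n)} {p : ZMod 2} {J : Finset G.edgeSet} :
    IsTPJoin G T p J ↔ edgeParity G (setExp J) = setParity T ∧ (#J : ZMod 2) = p := by
  refine and_congr_left fun _ => ?_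
  rw [funext_iff]
  refine forall_congr' fun i => ?_
  rw [edgeParity_setExp, setParity]
  split_ifs with h
  · simp [h, ZMod.natCast_eq_one_iff_odd]
  · simp [h, ZMod.natCast_eq_zero_iff_even]

theorem exists_setParity_eq (q : Fin n → ZMod 2) : ∃ T : Finset (Fin n), setParity T = q := by
  refine ⟨univ.filter (q · = 1), funext fun i => ?_⟩
  have key : ∀ x : ZMod 2, (if x = 1 then 1 else 0) = x := by decide
  simp [setParity, key]

theorem IsMinJoin.exists_eq_setExp {T : Finset (Fin n)} {p : ZMod 2} {J : Finset G.edgeSet}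
    (hJ : IsMinJoin G T p J) {γ : G.edgeSet →₀ ℕ} (hd : γ.degree = #J)
    (hp : edgeParity G γ = setParity T) : ∃ L, IsMinJoin G T p L ∧ γ = setExp L := by
  obtain ⟨L, h, rfl⟩ := exists_setExp_add γ
  rw [map_add, degree_setExp, map_nsmul, smul_eq_mul] at hd
  rw [map_add, edgeParity_two_nsmul, add_zero] at hp
  have hL : IsTPJoin G T p L := by
    refine isTPJoin_iff.2 ⟨hp, ?_⟩
    rw [← (isTPJoin_iff.1 hJ.1).2, ← hd, Nat.cast_add, Nat.cast_mul]
    simp [show (2 : ZMod 2) = 0 from rfl]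
  have hle := hJ.2 L hL
  obtain rfl : h = 0 := (Finsupp.degree_eq_zero_iff h).1 (by omega)
  exact ⟨L, ⟨hL, fun J' hJ' => by have := hJ.2 J' hJ'; omega⟩, by simp⟩

theorem JoinEquiv.refl {T : Finset (Fin n)} {p : ZMod 2} {J : Finset G.edgeSet}
    (hJ : IsMinJoin G T p J) : JoinEquiv G T p J J :=
  ⟨0, fun _ => J, rfl, rfl, fun _ _ => hJ, by simp⟩

theorem JoinEquiv.snoc {T : Finset (Fin n)} {p : ZMod 2} {J L M : Finset G.edgeSet}
    (h : JoinEquiv G T p J L) (hM : IsMinJoin G T p M) (hLM : (L ∩ M).Nonempty) :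
    JoinEquiv G T p J M := by
  obtain ⟨r, N, h₀, hr, hmin, hne⟩ := h
  refine ⟨r + 1, fun i => if i ≤ r then N i else M, by simp [h₀], by simp, fun i hi => ?_,
    fun i hi => ?_⟩
  · dsimp only
    split_ifs with h
    exacts [hmin i h, hM]
  · rcases (Nat.lt_succ_iff.1 hi).lt_or_eq with h | rfl
    · simpa [h.le, Nat.succ_le_of_lt h] using hne i h
    · simpa [hr] using hLM

theorem JoinEquiv.isMinJoin {T : Finset (Fin n)} {p : ZMod 2} {J L : Finset G.edgeSet}
    (h : JoinEquiv G T p J L) : IsMinJoin G T p L := by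
  obtain ⟨r, N, -, rfl, hmin, -⟩ := h
  exact hmin r le_rfl

theorem IsMinJoin.card_eq {T : Finset (Fin n)} {p : ZMod 2} {J L : Finset G.edgeSet}
    (hJ : IsMinJoin G T p J) (hL : IsMinJoin G T p L) : #J = #L :=
  (hJ.2 L hL.1).antisymm (hL.2 J hJ.1)

theorem JoinEquiv.lowCongruent (K : Type*) [Field K] {T : Finset (Fin n)} {p : ZMod 2}
    {J L : Finset G.edgeSet} (h : JoinEquiv G T p J L) :
    LowCongruent K G #J (setExp J) (setExp L) := by
  obtain ⟨r, N, rfl, rfl, hmin, hne⟩ := h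
  suffices ∀ i ≤ r, LowCongruent K G #(N 0) (setExp (N 0)) (setExp (N i)) from this r le_rfl
  intro i
  induction i with
  | zero => exact fun _ => .refl K _ _
  | succ i ih =>
    intro hi
    refine (ih (by omega)).trans ?_
    obtain ⟨e, he⟩ := hne i hi
    rw [Finset.mem_inter] at he
    have h₀ := hmin 0 (by omega)
    have h₁ := hmin i (by omega)
    have h₂ := hmin (i + 1) hi
    rw [LowCongruent, h₀.card_eq h₁, ← degree_setExp]
    refine monomial_sub_mem_lowDegreeIdeal K ?_ ?_
      ⟨e, setExp_ne_zero.2 he.1, setExp_ne_zero.2 he.2⟩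
    · rw [degree_setExp, degree_setExp, h₁.card_eq h₂]
    · rw [(isTPJoin_iff.1 h₁.1).1, (isTPJoin_iff.1 h₂.1).1]

theorem X_sq_sub_X_sq_notMem_lowDegreeIdeal (K : Type*) [Field K] {e l : G.edgeSet}
    (hel : e ≠ l) : (X e ^ 2 - X l ^ 2 : MvPolynomial G.edgeSet K) ∉ lowDegreeIdeal K G 2 := by
  have hC : IsLinkClosed G 2 0 {Finsupp.single e 2} := by
    refine ⟨by simp, ?_, ?_⟩
    · rintro _ rfl
      simpa using edgeParity_two_nsmul (Finsupp.single e 1)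
    · rintro _ rfl δ hd hp ⟨m, hm, hm'⟩
      obtain ⟨l, rfl⟩ := eq_single_of_degree_two hd hp
      rw [Finsupp.single_apply_ne_zero] at hm hm'
      rw [Set.mem_singleton_iff, ← hm.1, ← hm'.1]
  intro h
  have := hC.coeffSum_eq_zero h
  simp [X_pow_eq_monomial, coeffSum_monomial, Finsupp.single_left_inj, hel.symm] at this

theorem tMon_sub_tMon_notMem_lowDegreeIdeal (K : Type*) [Field K] {T : Finset (Fin n)}
    {p : ZMod 2} {J L : Finset G.edgeSet} (hJ : IsMinJoin G T p J)
    (hJL : ¬ JoinEquiv G T p J L) : tMon K G J - tMon K G L ∉ lowDegreeIdeal K G #J := by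
  have hC : IsLinkClosed G #J (setParity T) {γ | ∃ M, JoinEquiv G T p J M ∧ γ = setExp M} := by
    refine ⟨?_, ?_, ?_⟩
    · rintro _ ⟨M, hM, rfl⟩
      rw [degree_setExp, hJ.card_eq hM.isMinJoin]
    · rintro _ ⟨M, hM, rfl⟩
      exact (isTPJoin_iff.1 hM.isMinJoin.1).1
    · rintro _ ⟨M, hM, rfl⟩ δ hd hp ⟨e, he, he'⟩
      obtain ⟨N, hN, rfl⟩ := hJ.exists_eq_setExp hd hp
      exact ⟨N, hM.snoc hN
        ⟨e, Finset.mem_inter.2 ⟨setExp_ne_zero.1 he, setExp_ne_zero.1 he'⟩⟩, rfl⟩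
  intro h
  have := hC.coeffSum_eq_zero h
  rw [map_sub, tMon_eq_monomial, tMon_eq_monomial, coeffSum_monomial, coeffSum_monomial,
    if_pos ⟨J, .refl hJ, rfl⟩, if_neg, sub_zero] at this
  · exact one_ne_zero this
  · rintro ⟨M, hM, hLM⟩
    exact hJL (setExp_injective hLM ▸ hM)

/-- A join whose exponent vector is not congruent to that of another edge set of the same
size and parity has minimum cardinality. -/
theorem isMinJoin_of_not_lowCongruent {K : Type*} [Field K] {T : Finset (Fin n)} {p : ZMod 2}
    {J L : Finset G.edgeSet} (hJ : IsTPJoin G T p J) (hL : IsTPJoin G T p L) (hc : #J = #L)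
    (h : ¬ LowCongruent K G #J (setExp J) (setExp L)) : IsMinJoin G T p J := by
  refine ⟨hJ, fun M hM => ?_⟩
  by_contra! hlt
  rw [isTPJoin_iff] at hJ hL hM
  obtain ⟨k, hk⟩ : Even (#J - #M) := by
    rw [← ZMod.natCast_eq_zero_iff_even, Nat.cast_sub hlt.le, hJ.2, hM.2, sub_self]
  obtain ⟨e, he⟩ : J.Nonempty := Finset.card_pos.1 (by omega)
  have hd : (setExp M + 2 • Finsupp.single e k).degree = #J := by
    rw [map_add, degree_setExp, map_nsmul, Finsupp.degree_single, smul_eq_mul]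
    omega
  have hp : edgeParity G (setExp M + 2 • Finsupp.single e k) = setParity T := by
    rw [map_add, edgeParity_two_nsmul, add_zero, hM.1]
  have hval : 2 ≤ (setExp M + 2 • Finsupp.single e k) e := by
    simp
    omega
  refine h (LowCongruent.trans (β := setExp M + 2 • Finsupp.single e k) ?_ ?_)
  · rw [← degree_setExp]
    exact monomial_sub_mem_lowDegreeIdeal K (by rw [hd, degree_setExp]) (by rw [hp, hJ.1])
      ⟨e, setExp_ne_zero.2 he, by omega⟩
  · rw [← hd]
    refine lowCongruent_of_two_le K (by rw [hd, degree_setExp, hc]) (by rw [hp, hL.1]) ?_ hval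
    intro h2
    rw [hd] at h2
    obtain rfl : M = ∅ := Finset.card_eq_zero.1 (by omega)
    obtain ⟨a, ha⟩ := eq_single_of_degree_two (γ := setExp J) (by rw [degree_setExp, h2])
      (by rw [hJ.1, ← hM.1]; simp [setExp])
    have := setExp_apply J a
    rw [ha, Finsupp.single_eq_same] at this
    split_ifs at this
    omega

theorem exists_minJoins_of_not_lowCongruent {K : Type*} [Field K] {α β : G.edgeSet →₀ ℕ}
    (hd : α.degree = β.degree) (hp : edgeParity G α = edgeParity G β)
    (h : ¬ LowCongruent K G α.degree α β) (hα : ∀ e, α e < 2) (hβ : ∀ e, β e < 2) :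
    ∃ (T : Finset (Fin n)) (p : ZMod 2) (J L : Finset G.edgeSet),
      IsMinJoin G T p J ∧ IsMinJoin G T p L ∧ ¬ JoinEquiv G T p J L ∧
        α = setExp J ∧ β = setExp L := by
  obtain ⟨J, rfl⟩ : ∃ J, setExp J = α := ⟨_, setExp_support hα⟩
  obtain ⟨L, rfl⟩ : ∃ L, setExp L = β := ⟨_, setExp_support hβ⟩
  rw [degree_setExp] at hd h
  rw [degree_setExp] at hd
  obtain ⟨T, hT⟩ := exists_setParity_eq (edgeParity G (setExp J))
  have hJ : IsTPJoin G T #J J := isTPJoin_iff.2 ⟨hT.symm, rfl⟩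
  have hL : IsTPJoin G T #J L := isTPJoin_iff.2 ⟨by rw [hT, hp], by rw [hd]⟩
  exact ⟨T, #J, J, L, isMinJoin_of_not_lowCongruent hJ hL hd h,
    isMinJoin_of_not_lowCongruent hL hJ hd.symm fun h' => h (by rw [hd]; exact h'.symm),
    fun h' => h (h'.lowCongruent K), rfl, rfl⟩

theorem exists_squares_of_not_lowCongruent {K : Type*} [Field K] {α β : G.edgeSet →₀ ℕ}
    (hd : α.degree = β.degree) (hp : edgeParity G α = edgeParity G β)
    (h : ¬ LowCongruent K G α.degree α β) {e : G.edgeSet} (he : 2 ≤ α e) :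
    ∃ e l, α = Finsupp.single e 2 ∧ β = Finsupp.single l 2 := by
  have h2 : α.degree = 2 := by
    by_contra h2
    exact h (lowCongruent_of_two_le K hd hp h2 he)
  obtain ⟨γ, rfl⟩ := exists_add_of_le (Finsupp.single_le_iff.2 he)
  have hγ := h2
  rw [map_add, Finsupp.degree_single] at hγ
  obtain rfl : γ = 0 := (Finsupp.degree_eq_zero_iff γ).1 (by omega)
  rw [add_zero] at *
  have h0 : edgeParity G (Finsupp.single e 2) = 0 := by
    simpa using edgeParity_two_nsmul (Finsupp.single e 1)
  obtain ⟨l, hl⟩ := eq_single_of_degree_two (γ := β) (by rw [← hd, h2]) (by rw [← hp, h0])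
  exact ⟨e, l, rfl, hl⟩

theorem degree_eq_of_isHomogeneous_sub {σ K : Type*} [Field K] {α β : σ →₀ ℕ} {d : ℕ}
    (hne : α ≠ β) (h : (monomial α 1 - monomial β 1 : MvPolynomial σ K).IsHomogeneous d) :
    α.degree = d ∧ β.degree = d := by
  classical
  constructor <;> by_contra hd <;> simpa [coeff_monomial, hne, hne.symm] using h.coeff_eq_zero hd

end EulerianMembership

/-- a nonzero homogeneous binomial `f` of degree `d` in `I(G)` is not in the
ideal generated by the elements of `I(G)` of degree less than `d` iff `f` is either of the
form `t_e² − t_ℓ²` for distinct edges `e, ℓ`, or of the form `t_J − t_K` for nonequivalent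
minimum cardinality `(T,p)`-joins `J` and `K`. -/
theorem stmt4 {n : ℕ} (K : Type*) [Field K] (G : SimpleGraph (Fin n))
    (hE : 2 ≤ G.edgeSet.ncard) (d : ℕ) (f : MvPolynomial G.edgeSet K) (hf0 : f ≠ 0)
    (α β : G.edgeSet →₀ ℕ) (hbin : f = monomial α (1 : K) - monomial β (1 : K))
    (hhom : f.IsHomogeneous d) (hfI : f ∈ eulerianIdeal K G) :
    f ∉ Ideal.span {g : MvPolynomial G.edgeSet K |
        g ∈ eulerianIdeal K G ∧ g.totalDegree < d} ↔
      ((∃ e l : G.edgeSet, e ≠ l ∧ f = X e ^ 2 - X l ^ 2) ∨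
        (∃ (T : Finset (Fin n)) (p : ZMod 2) (J K' : Finset G.edgeSet),
          IsMinJoin G T p J ∧ IsMinJoin G T p K' ∧ ¬ JoinEquiv G T p J K' ∧
          f = tMon K G J - tMon K G K')) := by
  change f ∉ lowDegreeIdeal K G d ↔ _
  constructor
  · subst hbin
    intro h
    have hne : α ≠ β := by
      rintro rfl
      exact hf0 (sub_self _)
    obtain ⟨rfl, hβ⟩ := degree_eq_of_isHomogeneous_sub hne hhom
    have hp := edgeParity_eq_of_sub_mem hfI
    have hsq (e l : G.edgeSet) (hα : α = Finsupp.single e 2) (hβ : β = Finsupp.single l 2) :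
        ∃ e l : G.edgeSet, e ≠ l ∧
          (monomial α 1 - monomial β 1 : MvPolynomial G.edgeSet K) = X e ^ 2 - X l ^ 2 := by
      refine ⟨e, l, ?_, by rw [hα, hβ, X_pow_eq_monomial, X_pow_eq_monomial]⟩
      rintro rfl
      exact hne (hα.trans hβ.symm)
    by_cases hα2 : ∃ e, 2 ≤ α e
    · obtain ⟨e, he⟩ := hα2
      obtain ⟨e, l, h₁, h₂⟩ := exists_squares_of_not_lowCongruent hβ.symm hp h he
      exact Or.inl (hsq e l h₁ h₂)
    by_cases hβ2 : ∃ e, 2 ≤ β e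
    · obtain ⟨e, he⟩ := hβ2
      obtain ⟨e, l, h₁, h₂⟩ := exists_squares_of_not_lowCongruent hβ hp.symm
        (fun h' => h (hβ ▸ h'.symm)) he
      exact Or.inl (hsq l e h₂ h₁)
    push Not at hα2 hβ2
    obtain ⟨T, p, J, L, hJ, hL, hJL, rfl, rfl⟩ :=
      exists_minJoins_of_not_lowCongruent hβ.symm hp h hα2 hβ2
    exact Or.inr ⟨T, p, J, L, hJ, hL, hJL, by rw [tMon_eq_monomial, tMon_eq_monomial]⟩
  · clear hbin
    rintro (⟨e, l, hel, rfl⟩ | ⟨T, p, J, L, hJ, hL, hJL, rfl⟩)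
    · have hne : Finsupp.single e 2 ≠ Finsupp.single l 2 :=
        fun h => hel (Finsupp.single_left_injective two_ne_zero h)
      rw [X_pow_eq_monomial, X_pow_eq_monomial] at hhom
      obtain ⟨rfl, -⟩ := degree_eq_of_isHomogeneous_sub hne hhom
      rw [Finsupp.degree_single]
      exact X_sq_sub_X_sq_notMem_lowDegreeIdeal K hel
    · have hne : setExp J ≠ setExp L := by
        intro h
        exact hf0 (by rw [tMon_eq_monomial, tMon_eq_monomial, h, sub_self])
      rw [tMon_eq_monomial, tMon_eq_monomial] at hhom
      obtain ⟨rfl, -⟩ := degree_eq_of_isHomogeneous_sub hne hhom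
      rw [degree_setExp]
      exact tMon_sub_tMon_notMem_lowDegreeIdeal K hJ hJL
end
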